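/- Let R : S → ℝ^d be a bounded function on a finite set S, and let ρ, ρ' be probability mass functions on S. Define H = ‖∑_{s∈S} ρ(s) R(s)‖ (Euclidean norm) and q = ⟨∑_{s∈S} ρ(s) R(s), ∑_{s'∈S} ρ'(s') R(s')⟩. Then q ≥ H·(H − 2·‖R‖_{∞,2}·‖ρ − ρ'‖_TV), where ‖R‖_{∞,2} = sqrt(∑_{i=1}^d (sup_{s∈S} |R(s)_i|)^2) and ‖ρ − ρ'‖_TV = (1/2)∑_{s∈S} |ρ(s) − ρ'(s)|. -/

import Mathlib

open Finset RealInnerProductSpace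

theorem stmt_0 {S : Type*} [Fintype S] [Nonempty S] {d : ℕ}
    (R : S → EuclideanSpace ℝ (Fin d)) (ρ ρ' : S → ℝ)
    (hρ : ∀ s, 0 ≤ ρ s) (hρ' : ∀ s, 0 ≤ ρ' s)
    (hρ1 : ∑ s, ρ s = 1) (hρ'1 : ∑ s, ρ' s = 1) :
    ⟪(∑ s, ρ s • R s), (∑ s, ρ' s • R s)⟫ ≥
      ‖∑ s, ρ s • R s‖ *
        (‖∑ s, ρ s • R s‖ -
          2 * Real.sqrt (∑ i, (⨆ s, |R s i|) ^ 2) *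
            ((1 / 2) * ∑ s, |ρ s - ρ' s|)) := by
  set a := ∑ s, ρ s • R s with ha
  set b := ∑ s, ρ' s • R s with hb
  set M := Real.sqrt (∑ i, (⨆ s, |R s i|) ^ 2) with hM
  have hR : ∀ s, ‖R s‖ ≤ M := by
    intro s
    rw [EuclideanSpace.norm_eq, hM]
    apply Real.sqrt_le_sqrt
    apply Finset.sum_le_sum
    intro i _
    rw [Real.norm_eq_abs]
    have h : |R s i| ≤ ⨆ s, |R s i| :=
      le_ciSup (f := fun s => |R s i|) (Set.finite_range _).bddAbove s
    exact pow_le_pow_left₀ (abs_nonneg _) h 2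
  have hab : ‖a - b‖ ≤ M * ∑ s, |ρ s - ρ' s| := by
    have h : a - b = ∑ s, (ρ s - ρ' s) • R s := by
      rw [ha, hb, ← Finset.sum_sub_distrib]
      exact Finset.sum_congr rfl fun s _ => (sub_smul _ _ _).symm
    rw [h, Finset.mul_sum]
    refine (norm_sum_le _ _).trans (Finset.sum_le_sum fun s _ => ?_)
    rw [norm_smul, Real.norm_eq_abs, mul_comm]
    exact mul_le_mul_of_nonneg_right (hR s) (abs_nonneg _)
  have h1 : inner ℝ a (a - b) ≤ ‖a‖ * ‖a - b‖ := real_inner_le_norm _ _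
  have h2 : ‖a‖ * ‖a - b‖ ≤ ‖a‖ * (M * ∑ s, |ρ s - ρ' s|) :=
    mul_le_mul_of_nonneg_left hab (norm_nonneg _)
  rw [inner_sub_right, real_inner_self_eq_norm_sq] at h1
  have h3 : inner ℝ a b ≥ ‖a‖ * (‖a‖ - 2 * M * ((1 / 2) * ∑ s, |ρ s - ρ' s|)) := by
    linarith
  exact h3
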